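/- Let g : Σ^i → ℝ satisfy: (1) there exist a state s₀ ∈ S, a discount factor λ ∈ (0,1), and a continuous function f on the space of state-action vectors such that g(σ) = f(t_λ(s₀,σ)) for every strategy σ ∈ Σ^i; and (2) g is quasiconcave under mixing: g([β(σ),(1-β)(σ')]) ≥ β·g(σ) + (1-β)·g(σ') for all σ,σ' ∈ Σ^i and β ∈ [0,1]. Then the set of stationary strategies x with g(x) = max_{σ∈Σ^i} g(σ) is a closed monovex subset of ℝ^{∑_{s∈S}|A^i(s)|}. -/

import Mathlib

open MeasureTheory Filter Topology
open scoped ENNReal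

noncomputable section

/-- A finite stochastic game: a finite set of players `I`, a finite set of states `S`,
finite nonempty action sets `A i s`, stage payoffs `u` bounded by `1` in absolute value,
and transition probabilities `q`. -/
structure StocGame where
  (I : Type)
  (S : Type)
  (A : I → S → Type)
  [fintypeI : Fintype I]
  [fintypeS : Fintype S]
  [decI : DecidableEq I]
  [decS : DecidableEq S]
  [fintypeA : ∀ i s, Fintype (A i s)]
  [decA : ∀ i s, DecidableEq (A i s)]
  [nonemptyA : ∀ i s, Nonempty (A i s)]
  (u : I → (s : S) → ((j : I) → A j s) → ℝ)
  (u_bdd : ∀ i s a, |u i s a| ≤ 1)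
  (q : (s : S) → ((j : I) → A j s) → S → ℝ)
  (q_nonneg : ∀ s a s', 0 ≤ q s a s')
  (q_sum : ∀ s a, ∑ s', q s a s' = 1)

namespace StocGame

attribute [instance] fintypeI fintypeS decI decS fintypeA decA nonemptyA

/-- A mixed action over a finite set of actions. -/
abbrev Mixed (α : Type) [Fintype α] : Type := {f : α → ℝ // (∀ a, 0 ≤ f a) ∧ ∑ a, f a = 1}

variable {G : StocGame}

/-- Action profiles available at state `s`. -/
abbrev Prof (G : StocGame) (s : G.S) : Type := (j : G.I) → G.A j s

/-- A pair of a state together with an action profile at that state. -/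
abbrev Step (G : StocGame) : Type := Σ s : G.S, G.Prof s

/-- A finite history: a (reversed) list of past (state, action profile) steps,
together with the current state. -/
abbrev Hist (G : StocGame) : Type := List G.Step × G.S

/-- A behavior strategy of player `i`. -/
abbrev BStrat (G : StocGame) (i : G.I) : Type := (h : G.Hist) → Mixed (G.A i h.2)

/-- A (behavior) strategy profile. -/
abbrev Profile (G : StocGame) : Type := (i : G.I) → G.BStrat i

/-- A stationary strategy of player `i`. -/
abbrev Stat (G : StocGame) (i : G.I) : Type := (s : G.S) → Mixed (G.A i s)

/-- A stationary strategy profile. -/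
abbrev StatProf (G : StocGame) : Type := (i : G.I) → G.Stat i

/-- The behavior strategy profile induced by a stationary strategy profile. -/
def toB (x : G.StatProf) : G.Profile := fun i h => x i h.2

/-- The behavior strategy induced by a stationary strategy. -/
def toB1 {i : G.I} (x : G.Stat i) : G.BStrat i := fun h => x h.2

/-- A stationary strategy profile is pure if at every state each player
puts probability `1` on a single action. -/
def IsPureStat (x : G.StatProf) : Prop :=
  ∀ (i : G.I) (s : G.S), ∃ a : G.A i s, ∀ b, (x i s).1 b = if b = a then 1 else 0

/-- The probability, under strategy profile `σ` and initial state `s0`, that the play follows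
the finite history whose (reversed) list of steps is the first argument and whose current
state is the second argument. -/
def probHistAux (s0 : G.S) (σ : G.Profile) : List G.Step → G.S → ℝ
  | [], s => if s = s0 then 1 else 0
  | ⟨s', a⟩ :: rest, s =>
      probHistAux s0 σ rest s' * (∏ i, (σ i (rest, s')).1 (a i)) * G.q s' a s

/-- The probability that the play follows the finite history `h`. -/
def probHist (s0 : G.S) (σ : G.Profile) (h : G.Hist) : ℝ := probHistAux s0 σ h.1 h.2

/-- The expected `lam`-discounted time `t_lam(s0,σ;s,a)` that the play spends at the
state-action pair `st = (s,a)`. -/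
def tStep (lam : ℝ) (s0 : G.S) (σ : G.Profile) (st : G.Step) : ℝ :=
  (1 - lam) *
    ∑' h : G.Hist, (if h.1.head? = some st then lam ^ (h.1.length - 1) * probHist s0 σ h else 0)

/-- The expected `lam`-discounted time that the play spends in the set of states `D`. -/
def tSet (lam : ℝ) (s0 : G.S) (σ : G.Profile) (D : Finset G.S) : ℝ :=
  ∑ st : G.Step, if st.1 ∈ D then tStep lam s0 σ st else 0

/-- The `lam`-discounted (unnormalized) payoff `U^i_lam(s0,σ;D)` that player `i` receives
while the play is in `D`. -/
def UD (lam : ℝ) (s0 : G.S) (σ : G.Profile) (i : G.I) (D : Finset G.S) : ℝ :=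
  ∑ st : G.Step, if st.1 ∈ D then tStep lam s0 σ st * G.u i st.1 st.2 else 0

/-- The `lam`-discounted payoff of player `i`. -/
def payoffD (lam : ℝ) (s0 : G.S) (σ : G.Profile) (i : G.I) : ℝ :=
  ∑ st : G.Step, tStep lam s0 σ st * G.u i st.1 st.2

/-- `Di` is a partition of the set of states. -/
def IsPartitionF (Di : Finset (Finset G.S)) : Prop :=
  ∀ s : G.S, ∃! D : Finset G.S, D ∈ Di ∧ s ∈ D

/-- The payoff of player `i` in the modified game, given the partition `Di` and
the cutoffs `c`. -/
def modPayoff (lam : ℝ) (s0 : G.S) (σ : G.Profile) (i : G.I)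
    (Di : Finset (Finset G.S)) (c : Finset G.S → ℝ) : ℝ :=
  ∑ D ∈ Di, min (UD lam s0 σ i D) (tSet lam s0 σ D * c D)

/-- The `lam`-discounted min-max value of player `i` in the original game. -/
def minmaxOrig (G : StocGame) (lam : ℝ) (s0 : G.S) (i : G.I) : ℝ :=
  ⨅ σ : G.Profile, ⨆ σi : G.BStrat i, payoffD lam s0 (Function.update σ i σi) i

/-- The `lam`-discounted max-min value of player `i` in the original game. -/
def maxminOrig (G : StocGame) (lam : ℝ) (s0 : G.S) (i : G.I) : ℝ :=
  ⨆ σi : G.BStrat i, ⨅ σ : G.Profile, payoffD lam s0 (Function.update σ i σi) i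

/-- The min-max value of player `i` in the modified game. -/
def minmaxMod (G : StocGame) (lam : ℝ) (s0 : G.S) (i : G.I)
    (Di : Finset (Finset G.S)) (c : Finset G.S → ℝ) : ℝ :=
  ⨅ σ : G.Profile, ⨆ σi : G.BStrat i,
    modPayoff lam s0 (Function.update σ i σi) i Di c

/-- The max-min value of player `i` in the modified game. -/
def maxminMod (G : StocGame) (lam : ℝ) (s0 : G.S) (i : G.I)
    (Di : Finset (Finset G.S)) (c : Finset G.S → ℝ) : ℝ :=
  ⨆ σi : G.BStrat i, ⨅ σ : G.Profile,
    modPayoff lam s0 (Function.update σ i σi) i Di c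

/-- The min-max value in stationary strategies of player `i` in the modified game. -/
def minmaxModStat (G : StocGame) (lam : ℝ) (s0 : G.S) (i : G.I)
    (Di : Finset (Finset G.S)) (c : Finset G.S → ℝ) : ℝ :=
  ⨅ x : G.StatProf, ⨆ xi : G.Stat i,
    modPayoff lam s0 (Function.update (toB x) i (toB1 xi)) i Di c

/-- The max-min value in stationary strategies of player `i` in the modified game. -/
def maxminModStat (G : StocGame) (lam : ℝ) (s0 : G.S) (i : G.I)
    (Di : Finset (Finset G.S)) (c : Finset G.S → ℝ) : ℝ :=
  ⨆ xi : G.Stat i, ⨅ x : G.StatProf,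
    modPayoff lam s0 (Function.update (toB x) i (toB1 xi)) i Di c

/-! ### Plays and the induced measure -/

/-- A play: the infinite sequence of (state, action profile) pairs. -/
abbrev Play (G : StocGame) : Type := ℕ → G.Step

instance : MeasurableSpace G.Step := ⊤

/-- The finite history consisting of the first `n` stages of the play `p`
(reversed list of the first `n` steps, together with the state at stage `n`). -/
def histOf (p : G.Play) : ℕ → G.Hist
  | 0 => ([], (p 0).1)
  | n + 1 => ((p n) :: (histOf p n).1, (p (n + 1)).1)

/-- The cylinder set of plays whose initial segment is the finite history `h`. -/
def cylSet (h : G.Hist) : Set G.Play := {p | histOf p h.1.length = h}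

/-- `μfam` is the family of probability measures on plays induced (via the
Ionescu–Tulcea theorem) by the initial state and the strategy profile:
it is characterized by being a probability measure giving each cylinder set
the probability of the corresponding finite history. -/
def IsInduced (μfam : G.S → G.Profile → Measure G.Play) : Prop :=
  (∀ s0 σ, IsProbabilityMeasure (μfam s0 σ)) ∧
  ∀ (s0 : G.S) (σ : G.Profile) (h : G.Hist),
    μfam s0 σ (cylSet h) = ENNReal.ofReal (probHist s0 σ h)

/-- A bounded stopping time (with respect to the filtration generated by finite histories). -/
def IsBddST (τ : G.Play → ℕ) : Prop :=
  (∃ B, ∀ p, τ p ≤ B) ∧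
  ∀ p p' n, τ p = n → histOf p n = histOf p' n → τ p' = n

/-- Two states lie in the same element of the partition `Di`. -/
def sameOf (Di : Finset (Finset G.S)) (s s' : G.S) : Prop := ∃ D ∈ Di, s ∈ D ∧ s' ∈ D

open Classical in
/-- The number of switches between elements of a partition along a play,
where the partition is described through the relation `r` ("being in the same element"). -/
def Zsw (r : G.S → G.S → Prop) (p : G.Play) : ℝ≥0∞ :=
  ∑' n : ℕ, if r (p n).1 (p (n + 1)).1 then 0 else 1

/-- The stopping times `τ^𝒟_k` indicating when the play moves from one element of
the partition (described by the relation `r`) to another. -/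
def switchT (r : G.S → G.S → Prop) (p : G.Play) : ℕ → ℕ∞
  | 0 => 0
  | k + 1 => sInf {n : ℕ∞ | ∃ m : ℕ, n = (m : ℕ∞) ∧ switchT r p k < (m : ℕ∞) ∧
      ¬ r (p (m - 1)).1 (p m).1}

/-- The expected average payoff of player `i` in the `N`-stage game. -/
def payoffN (μfam : G.S → G.Profile → Measure G.Play) (N : ℕ) (s0 : G.S)
    (σ : G.Profile) (i : G.I) : ℝ :=
  (∫ p, (∑ n ∈ Finset.range N, G.u i (p n).1 (p n).2) ∂(μfam s0 σ)) / N

/-- `σi` is a uniform `ε`-max-min strategy of player `i` (with respect to the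
uniform max-min value function `v`). -/
def UnifMaxMin (μfam : G.S → G.Profile → Measure G.Play) (v : G.S → ℝ) (i : G.I)
    (σi : G.BStrat i) (ε : ℝ) : Prop :=
  ∃ lam0 : ℝ, 0 ≤ lam0 ∧ lam0 < 1 ∧ ∃ N0 : ℕ,
    ∀ (s0 : G.S) (σ : G.Profile),
      (∀ lam : ℝ, lam0 < lam → lam < 1 →
        v s0 - ε ≤ payoffD lam s0 (Function.update σ i σi) i) ∧
      (∀ τ : G.Play → ℕ, IsBddST τ →
        (N0 : ℝ) ≤ ∫ p, (τ p : ℝ) ∂(μfam s0 (Function.update σ i σi)) →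
        (v s0 - ε) * ∫ p, (τ p : ℝ) ∂(μfam s0 (Function.update σ i σi)) ≤
          ∫ p, (∑ n ∈ Finset.range (τ p), G.u i (p n).1 (p n).2)
            ∂(μfam s0 (Function.update σ i σi)))

/-- `σi` is `(𝒟,ε)`-max-min preserving, where the partition `𝒟` is described by the
relation `r`, and the conditional-expectation requirement is expressed through
integrals over the atoms (cylinder sets) of the σ-algebra of the stopping time `τ^𝒟_k`. -/
def PreservingPart (μfam : G.S → G.Profile → Measure G.Play) (v : G.S → ℝ)
    (r : G.S → G.S → Prop) (i : G.I) (σi : G.BStrat i) (ε : ℝ) : Prop :=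
  ∀ (s0 : G.S) (σ : G.Profile) (k : ℕ) (τ' : G.Play → ℕ), IsBddST τ' →
    (∀ p, switchT r p k ≠ ⊤ →
      switchT r p k < (τ' p : ℕ∞) ∧ (τ' p : ℕ∞) ≤ switchT r p (k + 1)) →
    ∀ h : G.Hist, (∀ p ∈ cylSet h, switchT r p k = (h.1.length : ℕ∞)) →
      ∫ p in cylSet h, (v h.2 - ε) ∂(μfam s0 (Function.update σ i σi)) ≤
        ∫ p in cylSet h, v ((p (τ' p)).1) ∂(μfam s0 (Function.update σ i σi))

/-- `σi` is `ε`-max-min preserving (with respect to arbitrary bounded stopping times);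
again the conditional-expectation requirement is expressed through integrals over the
atoms of the σ-algebra of the stopping time `τ`. -/
def PreservingST (μfam : G.S → G.Profile → Measure G.Play) (v : G.S → ℝ) (i : G.I)
    (σi : G.BStrat i) (ε : ℝ) : Prop :=
  ∀ (s0 : G.S) (σ : G.Profile) (τ τ' : G.Play → ℕ), IsBddST τ → IsBddST τ' →
    (∀ p, τ p < τ' p) →
    ∀ h : G.Hist, (∀ p ∈ cylSet h, τ p = h.1.length) →
      ∫ p in cylSet h, (v h.2 - ε) ∂(μfam s0 (Function.update σ i σi)) ≤
        ∫ p in cylSet h, v ((p (τ' p)).1) ∂(μfam s0 (Function.update σ i σi))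

/-- A history enters a new element of the partition (described by `r`) at its final stage. -/
def entersNew (r : G.S → G.S → Prop) (h : G.Hist) : Prop :=
  match h.1 with
  | [] => True
  | st :: _ => ¬ r st.1 h.2

/-- `σi` is `𝒟`-Markovian: its continuation strategy coincides after any two finite histories
that end at the same state and whose final stage enters a new element of the partition
(described by `r`). -/
def Markovian (r : G.S → G.S → Prop) {i : G.I} (σi : G.BStrat i) : Prop :=
  ∀ h h' : G.Hist, h.2 = h'.2 → entersNew r h → entersNew r h' →
    ∀ (l : List G.Step) (s'' : G.S), σi (l ++ h.1, s'') = σi (l ++ h'.1, s'')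

open Classical in
/-- The portion of the history since the last time the play entered a new element of the
partition (described by `r`): (reversed) list of steps, given the current state. -/
def philist (r : G.S → G.S → Prop) : List G.Step → G.S → List G.Step
  | [], _ => []
  | st :: rest, s => if r st.1 s then st :: philist r rest st.1 else []

/-- The restart strategy `σ^i_𝒟`: whenever the play enters a new element of the partition
(described by `r`), player `i` forgets past play and restarts playing `σi`. -/
def restart {i : G.I} (σi : G.BStrat i) (r : G.S → G.S → Prop) : G.BStrat i :=
  fun h => σi (philist r h.1 h.2, h.2)

/-- The partition `Di` satisfies Property P with respect to player `i`
(whose uniform max-min value function is `v`). -/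
def PropertyP (μfam : G.S → G.Profile → Measure G.Play) (v : G.S → ℝ) (i : G.I)
    (Di : Finset (Finset G.S)) : Prop :=
  ∃ ζ : ℝ, 0 < ζ ∧ ∀ ε : ℝ, 0 < ε → ∃ σi : G.BStrat i,
    Markovian (sameOf Di) σi ∧ UnifMaxMin μfam v i σi ε ∧
    ∀ (s0 : G.S) (σ : G.Profile), ∃ E : Set G.Play,
      ENNReal.ofReal (1 - ε) < μfam s0 (Function.update σ i σi) E ∧
      ∫⁻ p in E, Zsw (sameOf Di) p ∂(μfam s0 (Function.update σ i σi)) ≤ ENNReal.ofReal ζ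

/-- The strategy profile `σ` (whose `i`-th coordinate is the strategy of player `i`) makes
player `i`'s strategy a uniform `𝒟`-subgame-perfect `ε`-min-max strategy against the others'
strategies, at the initial state `s0`; `vbar` is the uniform min-max value function of
player `i`, and the partition `𝒟` is described by the relation `r`.  Conditional-expectation
requirements are expressed through integrals over the atoms (cylinder sets) of the σ-algebra
of the stopping time `τ^𝒟_k`. -/
def SubgamePerfect (μfam : G.S → G.Profile → Measure G.Play) (vbar : G.S → ℝ)
    (r : G.S → G.S → Prop) (i : G.I) (σ : G.Profile) (s0 : G.S) (ε : ℝ) : Prop :=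
  ∃ N0 : ℕ, 0 < N0 ∧
    (∀ N : ℕ, N0 ≤ N → vbar s0 - ε ≤ payoffN μfam N s0 σ i) ∧
    (∀ (k : ℕ) (τ : G.Play → ℕ), IsBddST τ → (∀ p, switchT r p k ≤ (τ p : ℕ∞)) →
      ∀ h : G.Hist, (∀ p ∈ cylSet h, switchT r p k = (h.1.length : ℕ∞)) →
        (∫ p in cylSet h, (vbar h.2 - ε) ∂(μfam s0 σ) ≤
          ∫ p in cylSet h, vbar ((p (τ p)).1) ∂(μfam s0 σ)) ∧
        ((N0 : ℝ) * (μfam s0 σ (cylSet h)).toReal ≤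
            ∫ p in cylSet h, ((τ p : ℝ) - (h.1.length : ℝ)) ∂(μfam s0 σ) →
          (vbar h.2 - ε) * ∫ p in cylSet h, ((τ p : ℝ) - (h.1.length : ℝ)) ∂(μfam s0 σ) ≤
            ∫ p in cylSet h, (∑ n ∈ Finset.Ico h.1.length (τ p), G.u i (p n).1 (p n).2)
              ∂(μfam s0 σ)))

/-- The partition `Di` satisfies Property P' with respect to player `i`
(whose uniform min-max value function is `vbar`). -/
def PropertyP' (μfam : G.S → G.Profile → Measure G.Play) (vbar : G.S → ℝ) (i : G.I)
    (Di : Finset (Finset G.S)) : Prop :=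
  ∃ ζ : ℝ, 0 < ζ ∧ ∀ ε : ℝ, 0 < ε → ∀ (s0 : G.S) (σ : G.Profile), ∃ σi : G.BStrat i,
    SubgamePerfect μfam vbar (sameOf Di) i (Function.update σ i σi) s0 ε ∧
    ∃ E : Set G.Play,
      ENNReal.ofReal (1 - ε) ≤ μfam s0 (Function.update σ i σi) E ∧
      ∫⁻ p in E, Zsw (sameOf Di) p ∂(μfam s0 (Function.update σ i σi)) ≤ ENNReal.ofReal ζ

/-! ### Reachability, closed and strongly controllable sets -/

/-- The first arrival time to the set of states `C`. -/
def hitT (C : Set G.S) (p : G.Play) : ℕ∞ :=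
  sInf {n : ℕ∞ | ∃ m : ℕ, n = (m : ℕ∞) ∧ (p m).1 ∈ C}

/-- State `s` leads in `D` to state `s'`. -/
def LeadsIn (μfam : G.S → G.Profile → Measure G.Play) (D : Set G.S) (s s' : G.S) : Prop :=
  ∃ σ : G.Profile, μfam s σ {p | hitT {s'} p < hitT Dᶜ p} = 1

/-- The states `s` and `s'` are `D`-siblings. -/
def Siblings (μfam : G.S → G.Profile → Measure G.Play) (D : Set G.S) (s s' : G.S) : Prop :=
  LeadsIn μfam D s s' ∧ LeadsIn μfam D s' s

/-- The probability `q(D | s, a)` that the next state lies in `D`. -/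
def qOf (D : Set G.S) (s : G.S) (a : G.Prof s) : ℝ := ∑ s', D.indicator (G.q s a) s'

/-- The set of states `D` is closed. -/
def ClosedSet (G : StocGame) (D : Set G.S) : Prop :=
  ∀ s ∈ D, ∀ a : G.Prof s, qOf D s a = 1

/-- The set of states `D` is strongly controllable. -/
def StronglyContr (G : StocGame) (D : Set G.S) : Prop :=
  ∃ iD : G.I, ∃ sD ∈ D, ∃ atil : G.A iD sD,
    ∀ s ∈ D, ∀ a : G.Prof s, qOf D s a < 1 → s = sD ∧ HEq (a iD) atil

/-- The element of the partition `𝒟` (by the vector of uniform min-max values `v`)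
that contains the state `s`. -/
def Dv (v : G.I → G.S → ℝ) (s : G.S) : Set G.S := {s' | ∀ i, v i s' = v i s}

/-- The element of the refined partition `𝒟*` (refining `𝒟` by the `D`-siblings relation)
that contains the state `s`. -/
def DstarCl (μfam : G.S → G.Profile → Measure G.Play) (v : G.I → G.S → ℝ) (s : G.S) :
    Set G.S := {s' | s' ∈ Dv v s ∧ Siblings μfam (Dv v s) s s'}

/-- The stochastic game is strongly controllable: every element of `𝒟*` is either closed
or strongly controllable. -/
def StronglyControllableGame (G : StocGame) (μfam : G.S → G.Profile → Measure G.Play)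
    (v : G.I → G.S → ℝ) : Prop :=
  ∀ s : G.S, ClosedSet G (DstarCl μfam v s) ∨ StronglyContr G (DstarCl μfam v s)

end StocGame

/-- A set `X ⊆ ℝ^ι` is monovex if every two points of `X` are connected by a continuous
path inside `X` all of whose coordinates are monotone. -/
def Monovex {ι : Type} (X : Set (ι → ℝ)) : Prop :=
  ∀ x ∈ X, ∀ y ∈ X, ∃ f : ℝ → ι → ℝ,
    ContinuousOn f (Set.Icc 0 1) ∧ (∀ t ∈ Set.Icc (0 : ℝ) 1, f t ∈ X) ∧
    f 0 = x ∧ f 1 = y ∧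
    ∀ j : ι, MonotoneOn (fun t => f t j) (Set.Icc 0 1) ∨
      AntitoneOn (fun t => f t j) (Set.Icc 0 1)

end

noncomputable section

namespace StocGame

variable {G : StocGame}

/-! ### Discounted occupation measures -/

/-- A list is either empty or a head followed by a tail. -/
def sumProdEquivList (α : Type) : Unit ⊕ (α × List α) ≃ List α where
  toFun := Sum.elim (fun _ => []) (fun p => p.1 :: p.2)
  invFun
    | [] => .inl ()
    | a :: l => .inr (a, l)
  left_inv := by rintro (_ | _) <;> rfl
  right_inv := by rintro (_ | _) <;> rfl

lemma hasSum_list {α M : Type} [AddCommMonoid M] [TopologicalSpace M] [ContinuousAdd M]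
    {F : List α → M} {b : M} (h : HasSum (fun p : α × List α => F (p.1 :: p.2)) b) :
    HasSum F (F [] + b) := by
  rw [← (sumProdEquivList α).hasSum_iff]
  exact HasSum.sum (hasSum_unique _) h

lemma ennreal_tsum_list {α : Type} (F : List α → ℝ≥0∞) :
    ∑' l, F l = F [] + ∑' l, ∑' a, F (a :: l) := by
  rw [(hasSum_list ENNReal.summable.hasSum).tsum_eq, ENNReal.tsum_prod', ENNReal.tsum_comm]

/-- The probability that the action profile `a` is played at the history `(l, s)`. -/
def actProb (σ : G.Profile) (l : List G.Step) (st : G.Step) : ℝ :=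
  ∏ i, (σ i (l, st.1)).1 (st.2 i)

lemma actProb_nonneg (σ : G.Profile) (l : List G.Step) (st : G.Step) : 0 ≤ actProb σ l st :=
  Finset.prod_nonneg fun i _ => (σ i (l, st.1)).2.1 _

lemma sum_actProb (σ : G.Profile) (l : List G.Step) (s : G.S) :
    ∑ a : G.Prof s, actProb σ l ⟨s, a⟩ = 1 := by
  have h := Finset.prod_univ_sum (fun j => (Finset.univ : Finset (G.A j s)))
    (fun j a => (σ j (l, s)).1 a)
  rw [Fintype.piFinset_univ] at h
  unfold actProb
  rw [← h]
  exact Finset.prod_eq_one fun j _ => (σ j (l, s)).2.2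

lemma probHistAux_cons (s0 : G.S) (σ : G.Profile) (st : G.Step) (l : List G.Step) (s : G.S) :
    probHistAux s0 σ (st :: l) s =
      probHistAux s0 σ l st.1 * actProb σ l st * G.q st.1 st.2 s := rfl

lemma probHistAux_nonneg (s0 : G.S) (σ : G.Profile) (l : List G.Step) (s : G.S) :
    0 ≤ probHistAux s0 σ l s := by
  induction l generalizing s with
  | nil => unfold probHistAux; split_ifs <;> norm_num
  | cons st l ih =>
    rw [probHistAux_cons]
    exact mul_nonneg (mul_nonneg (ih _) (actProb_nonneg _ _ _)) (G.q_nonneg _ _ _)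

lemma sum_probHistAux_cons (s0 : G.S) (σ : G.Profile) (l : List G.Step) :
    ∑ st : G.Step, ∑ s, probHistAux s0 σ (st :: l) s = ∑ s, probHistAux s0 σ l s := by
  simp_rw [probHistAux_cons, ← Finset.mul_sum, G.q_sum, mul_one]
  rw [Fintype.sum_sigma]
  simp_rw [← Finset.mul_sum, sum_actProb, mul_one]

lemma tsum_probHistAux_length (s0 : G.S) (σ : G.Profile) (n : ℕ) :
    ∑' l : List G.Step,
      (if l.length = n then ENNReal.ofReal (∑ s, probHistAux s0 σ l s) else 0) = 1 := by
  induction n with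
  | zero =>
    rw [ennreal_tsum_list]
    simp [probHistAux]
  | succ n ih =>
    rw [ennreal_tsum_list, ← ih]
    simp only [List.length_nil, List.length_cons, add_left_inj, tsum_fintype]
    rw [if_neg (by omega), zero_add]
    refine tsum_congr fun l => ?_
    split_ifs with h
    · rw [← sum_probHistAux_cons, ENNReal.ofReal_sum_of_nonneg]
      exact fun st _ => Finset.sum_nonneg fun s _ => probHistAux_nonneg _ _ _ _
    · simp

/-- The discounted weight of a finite history. -/
def histWeight (lam : ℝ) (s0 : G.S) (σ : G.Profile) (h : G.Hist) : ℝ :=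
  lam ^ h.1.length * probHistAux s0 σ h.1 h.2

lemma histWeight_nonneg {lam : ℝ} (hlam : 0 ≤ lam) (s0 : G.S) (σ : G.Profile) (h : G.Hist) :
    0 ≤ histWeight lam s0 σ h :=
  mul_nonneg (pow_nonneg hlam _) (probHistAux_nonneg _ _ _ _)

lemma ennreal_tsum_histWeight {lam : ℝ} (hlam : 0 ≤ lam) (s0 : G.S) (σ : G.Profile) :
    ∑' h, ENNReal.ofReal (histWeight lam s0 σ h) = (1 - ENNReal.ofReal lam)⁻¹ := by
  rw [ENNReal.tsum_prod', ← ENNReal.tsum_geometric]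
  have key : ∀ l : List G.Step, ∑' s, ENNReal.ofReal (histWeight lam s0 σ (l, s)) =
      ∑' n, ENNReal.ofReal lam ^ n *
        (if l.length = n then ENNReal.ofReal (∑ s, probHistAux s0 σ l s) else 0) := by
    intro l
    rw [tsum_eq_single l.length (by intro n hn; simp [Ne.symm hn]), tsum_fintype,
      ← ENNReal.ofReal_sum_of_nonneg fun s _ => histWeight_nonneg hlam _ _ _]
    simp only [histWeight, ← Finset.mul_sum, if_true]
    rw [ENNReal.ofReal_mul (pow_nonneg hlam _), ENNReal.ofReal_pow hlam]
  simp_rw [key]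
  rw [ENNReal.tsum_comm]
  simp_rw [ENNReal.tsum_mul_left, tsum_probHistAux_length, mul_one]

lemma ennreal_tsum_histWeight_ne_top {lam : ℝ} (hlam : 0 ≤ lam) (hlam1 : lam < 1) (s0 : G.S)
    (σ : G.Profile) : ∑' h, ENNReal.ofReal (histWeight lam s0 σ h) ≠ ⊤ := by
  rw [ennreal_tsum_histWeight hlam, ENNReal.inv_ne_top, Ne, tsub_eq_zero_iff_le, not_le]
  exact ENNReal.ofReal_lt_one.2 hlam1

lemma summable_histWeight {lam : ℝ} (hlam : 0 ≤ lam) (hlam1 : lam < 1) (s0 : G.S)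
    (σ : G.Profile) : Summable (histWeight lam s0 σ) := by
  have h := ENNReal.summable_toReal (ennreal_tsum_histWeight_ne_top hlam hlam1 s0 σ)
  simpa only [ENNReal.toReal_ofReal (histWeight_nonneg hlam s0 σ _)] using h

lemma tsum_histWeight {lam : ℝ} (hlam : 0 ≤ lam) (s0 : G.S) (σ : G.Profile) :
    ∑' h, histWeight lam s0 σ h = ((1 - ENNReal.ofReal lam)⁻¹).toReal := by
  rw [← ennreal_tsum_histWeight hlam s0 σ, ENNReal.tsum_toReal_eq fun _ => ENNReal.ofReal_ne_top]
  simp only [ENNReal.toReal_ofReal (histWeight_nonneg hlam s0 σ _)]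

/-- The state-action time vectors of all strategy profiles lie in a common box. -/
lemma exists_tStep_mem_Icc {lam : ℝ} (hlam : 0 < lam) (hlam1 : lam < 1) (s0 : G.S) :
    ∃ C : ℝ, ∀ (σ : G.Profile) (st : G.Step), tStep lam s0 σ st ∈ Set.Icc 0 C := by
  refine ⟨(1 - lam) * (lam⁻¹ * ((1 - ENNReal.ofReal lam)⁻¹).toReal), fun σ st => ?_⟩
  have h1 : 0 ≤ 1 - lam := by linarith
  have hnn : ∀ h : G.Hist, 0 ≤
      (if h.1.head? = some st then lam ^ (h.1.length - 1) * probHist s0 σ h else 0) := by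
    intro h
    split_ifs
    · exact mul_nonneg (pow_nonneg hlam.le _) (probHistAux_nonneg _ _ _ _)
    · exact le_rfl
  have hle : ∀ h : G.Hist,
      (if h.1.head? = some st then lam ^ (h.1.length - 1) * probHist s0 σ h else 0) ≤
        lam⁻¹ * histWeight lam s0 σ h := by
    rintro ⟨_ | ⟨st', l⟩, s⟩
    · simpa using mul_nonneg (inv_nonneg.2 hlam.le) (histWeight_nonneg hlam.le s0 σ _)
    · split_ifs
      · refine le_of_eq ?_
        simp only [List.length_cons, Nat.add_sub_cancel, histWeight, probHist, pow_succ]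
        field_simp
      · exact mul_nonneg (inv_nonneg.2 hlam.le) (histWeight_nonneg hlam.le s0 σ _)
  have hs := (summable_histWeight hlam.le hlam1 s0 σ).mul_left lam⁻¹
  refine ⟨mul_nonneg h1 (tsum_nonneg hnn), mul_le_mul_of_nonneg_left ?_ h1⟩
  rw [← tsum_histWeight hlam.le s0 σ, ← tsum_mul_left]
  exact (Summable.of_nonneg_of_le hnn hle hs).tsum_le_tsum hle hs

/-! ### Stationary profiles -/

/-- The probability that the stationary profile `x` plays the given action profile
at the given state. -/
def statProb (x : G.StatProf) (st : G.Step) : ℝ := ∏ i, (x i st.1).1 (st.2 i)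

lemma actProb_toB (x : G.StatProf) (l : List G.Step) (st : G.Step) :
    actProb (toB x) l st = statProb x st := rfl

/-- The expected discounted time spent at each state under a stationary profile. -/
def stateTime (lam : ℝ) (s0 : G.S) (x : G.StatProf) (s : G.S) : ℝ :=
  (1 - lam) * ∑' l : List G.Step, histWeight lam s0 (toB x) (l, s)

lemma stateTime_nonneg {lam : ℝ} (hlam : 0 ≤ lam) (hlam1 : lam < 1) (s0 : G.S)
    (x : G.StatProf) (s : G.S) : 0 ≤ stateTime lam s0 x s :=
  mul_nonneg (by linarith) (tsum_nonneg fun _ => histWeight_nonneg hlam _ _ _)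

lemma summable_histWeight_left {lam : ℝ} (hlam : 0 ≤ lam) (hlam1 : lam < 1) (s0 : G.S)
    (σ : G.Profile) (s : G.S) : Summable fun l => histWeight lam s0 σ (l, s) :=
  (summable_histWeight hlam hlam1 s0 σ).comp_injective (i := fun l => (l, s))
    fun _ _ h => (Prod.mk.inj h).1

/-- Summation over a product whose first factor is finite. -/
lemma hasSum_prod_fintype {α β : Type} [Fintype α] {F : α × β → ℝ} {a : α → ℝ}
    (h : ∀ x, HasSum (fun y => F (x, y)) (a x)) : HasSum F (∑ x, a x) := by
  classical
  have hx : ∀ x, HasSum (fun p : α × β => if p.1 = x then F p else 0) (a x) := by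
    intro x
    rw [← (Prod.mk_right_injective x).hasSum_iff]
    · simpa [Function.comp_def] using h x
    · rintro ⟨x', y⟩ hp
      rw [if_neg]
      rintro rfl
      exact hp ⟨y, rfl⟩
  simpa using hasSum_sum (s := Finset.univ) fun x _ => hx x

lemma histWeight_cons (lam : ℝ) (s0 : G.S) (x : G.StatProf) (st : G.Step) (l : List G.Step)
    (s : G.S) : histWeight lam s0 (toB x) (st :: l, s) =
      histWeight lam s0 (toB x) (l, st.1) * (lam * (statProb x st * G.q st.1 st.2 s)) := by
  simp only [histWeight, probHistAux_cons, actProb_toB, List.length_cons, pow_succ]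
  ring

lemma hasSum_head_eq {lam : ℝ} (hlam : 0 ≤ lam) (hlam1 : lam < 1) (s0 : G.S) (x : G.StatProf)
    (st : G.Step) (s : G.S) : HasSum (fun l : List G.Step =>
      if l.head? = some st then lam ^ (l.length - 1) * probHist s0 (toB x) (l, s) else 0)
      ((∑' l : List G.Step, histWeight lam s0 (toB x) (l, st.1)) *
        (statProb x st * G.q st.1 st.2 s)) := by
  have h := hasSum_prod_fintype (α := G.Step) (β := List G.Step)
    (F := fun p => if (p.1 :: p.2).head? = some st then
      lam ^ ((p.1 :: p.2).length - 1) * probHist s0 (toB x) (p.1 :: p.2, s) else 0)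
    (a := fun st' => if st' = st then
      (∑' l : List G.Step, histWeight lam s0 (toB x) (l, st.1)) *
        (statProb x st * G.q st.1 st.2 s) else 0) ?_
  · have h' := hasSum_list (F := fun l : List G.Step =>
      if l.head? = some st then lam ^ (l.length - 1) * probHist s0 (toB x) (l, s) else 0) h
    simp only [Finset.sum_ite_eq', Finset.mem_univ, if_true, List.head?_nil, reduceCtorEq,
      if_false, zero_add] at h'
    exact h'
  · intro st'
    by_cases hst : st' = st
    · subst hst
      simp only [List.head?_cons, if_true, List.length_cons, Nat.add_sub_cancel]
      refine ((summable_histWeight_left hlam hlam1 s0 (toB x) st'.1).hasSum.mul_right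
        (statProb x st' * G.q st'.1 st'.2 s)).congr_fun fun l => ?_
      simp only [probHist, probHistAux_cons, actProb_toB, histWeight]
      ring
    · simp only [List.head?_cons, Option.some.injEq, hst, if_false]
      exact hasSum_zero

lemma tStep_toB {lam : ℝ} (hlam : 0 ≤ lam) (hlam1 : lam < 1) (s0 : G.S) (x : G.StatProf)
    (st : G.Step) : tStep lam s0 (toB x) st = stateTime lam s0 x st.1 * statProb x st := by
  have h : HasSum (fun h : G.Hist => if h.1.head? = some st then
      lam ^ (h.1.length - 1) * probHist s0 (toB x) h else 0) _ :=
    (Equiv.prodComm G.S (List G.Step)).hasSum_iff.1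
      (hasSum_prod_fintype (hasSum_head_eq hlam hlam1 s0 x st))
  rw [tStep, h.tsum_eq, ← Finset.mul_sum, ← Finset.mul_sum, G.q_sum, stateTime, mul_one, mul_assoc]

/-- `m` is invariant for the discounted flow with initial state `s0` under the
transition probabilities weighted by `p`. -/
def IsFlow (lam : ℝ) (s0 : G.S) (p : G.Step → ℝ) (m : G.S → ℝ) : Prop :=
  ∀ s, m s = (1 - lam) * (if s = s0 then 1 else 0) +
    lam * ∑ st : G.Step, m st.1 * p st * G.q st.1 st.2 s

lemma isFlow_stateTime {lam : ℝ} (hlam : 0 ≤ lam) (hlam1 : lam < 1) (s0 : G.S)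
    (x : G.StatProf) : IsFlow lam s0 (statProb x) (stateTime lam s0 x) := by
  intro s
  have h := hasSum_list (F := fun l : List G.Step => histWeight lam s0 (toB x) (l, s))
    (hasSum_prod_fintype fun st => by
      simpa only [histWeight_cons] using
        (summable_histWeight_left hlam hlam1 s0 (toB x) st.1).hasSum.mul_right
          (lam * (statProb x st * G.q st.1 st.2 s)))
  rw [stateTime, h.tsum_eq, mul_add, Finset.mul_sum, Finset.mul_sum]
  congr 1
  · simp [histWeight, probHistAux]
  · refine Finset.sum_congr rfl fun st _ => ?_
    rw [stateTime]
    ring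

lemma sum_statProb (x : G.StatProf) (s : G.S) : ∑ a : G.Prof s, statProb x ⟨s, a⟩ = 1 :=
  sum_actProb (toB x) [] s

lemma statProb_nonneg (x : G.StatProf) (st : G.Step) : 0 ≤ statProb x st :=
  actProb_nonneg (toB x) [] st

lemma sum_step_flow (p : G.Step → ℝ) (hp : ∀ s, ∑ a : G.Prof s, p ⟨s, a⟩ = 1) (m : G.S → ℝ) :
    ∑ s, ∑ st : G.Step, m st.1 * p st * G.q st.1 st.2 s = ∑ s, m s := by
  rw [Finset.sum_comm]
  simp_rw [← Finset.mul_sum, G.q_sum, mul_one]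
  rw [Fintype.sum_sigma]
  simp_rw [← Finset.mul_sum, hp, mul_one]

/-- The discounted flow equation has a unique solution. -/
lemma IsFlow.eq {lam : ℝ} (hlam : 0 ≤ lam) (hlam1 : lam < 1) {s0 : G.S} {x : G.StatProf}
    {m m' : G.S → ℝ} (hm : IsFlow lam s0 (statProb x) m) (hm' : IsFlow lam s0 (statProb x) m') :
    m = m' := by
  have hd : ∀ s, |m s - m' s| ≤
      lam * ∑ st : G.Step, |m st.1 - m' st.1| * statProb x st * G.q st.1 st.2 s := by
    intro s
    rw [hm s, hm' s, add_sub_add_left_eq_sub, ← mul_sub, ← Finset.sum_sub_distrib, abs_mul,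
      abs_of_nonneg hlam]
    refine mul_le_mul_of_nonneg_left ((Finset.abs_sum_le_sum_abs _ _).trans_eq ?_) hlam
    refine Finset.sum_congr rfl fun st _ => ?_
    rw [← sub_mul, ← sub_mul, abs_mul, abs_mul, abs_of_nonneg (statProb_nonneg x st),
      abs_of_nonneg (G.q_nonneg _ _ _)]
  have hsum := Finset.sum_le_sum fun s (_ : s ∈ Finset.univ) => hd s
  rw [← Finset.mul_sum, sum_step_flow _ (sum_statProb x) fun s => |m s - m' s|] at hsum
  have hnn : 0 ≤ ∑ s, |m s - m' s| := Finset.sum_nonneg fun _ _ => abs_nonneg _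
  have h0 : ∑ s, |m s - m' s| = 0 := by nlinarith
  funext s
  have := (Finset.sum_eq_zero_iff_of_nonneg fun _ _ => abs_nonneg _).1 h0 s (Finset.mem_univ s)
  exact sub_eq_zero.1 (abs_eq_zero.1 this)

lemma sum_stateTime {lam : ℝ} (hlam : 0 ≤ lam) (hlam1 : lam < 1) (s0 : G.S) (x : G.StatProf) :
    ∑ s, stateTime lam s0 x s = 1 := by
  have h := Finset.sum_congr rfl
    fun s (_ : s ∈ Finset.univ) => isFlow_stateTime hlam hlam1 s0 x s
  rw [Finset.sum_add_distrib, ← Finset.mul_sum, ← Finset.mul_sum,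
    sum_step_flow _ (sum_statProb x)] at h
  simp only [Finset.sum_ite_eq', Finset.mem_univ, if_true] at h
  have : (1 - lam) * (∑ s, stateTime lam s0 x s - 1) = 0 := by linarith
  rcases mul_eq_zero.1 this with h' | h' <;> linarith

lemma stateTime_mem_Icc {lam : ℝ} (hlam : 0 ≤ lam) (hlam1 : lam < 1) (s0 : G.S)
    (x : G.StatProf) (s : G.S) : stateTime lam s0 x s ∈ Set.Icc 0 1 := by
  refine ⟨stateTime_nonneg hlam hlam1 s0 x s, ?_⟩
  rw [← sum_stateTime hlam hlam1 s0 x]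
  exact Finset.single_le_sum (fun s _ => stateTime_nonneg hlam hlam1 s0 x s) (Finset.mem_univ s)

lemma IsFlow.mix {lam : ℝ} {s0 : G.S} {p p' r : G.Step → ℝ} {m m' : G.S → ℝ}
    (hm : IsFlow lam s0 p m) (hm' : IsFlow lam s0 p' m') (β : ℝ)
    (hr : ∀ st : G.Step, (β * m st.1 + (1 - β) * m' st.1) * r st =
      β * (m st.1 * p st) + (1 - β) * (m' st.1 * p' st)) :
    IsFlow lam s0 r fun s => β * m s + (1 - β) * m' s := by
  intro s
  simp_rw [hr, add_mul, Finset.sum_add_distrib, mul_assoc, ← Finset.mul_sum]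
  simp_rw [← mul_assoc]
  rw [hm s, hm' s]
  ring

/-- A stationary profile that disintegrates a mixture of two state-action time vectors
induces this mixture. -/
lemma tStep_toB_mix {lam : ℝ} (hlam : 0 ≤ lam) (hlam1 : lam < 1) (s0 : G.S)
    {x y z : G.StatProf} (β : ℝ)
    (hz : ∀ st : G.Step,
      (β * stateTime lam s0 x st.1 + (1 - β) * stateTime lam s0 y st.1) * statProb z st =
        β * (stateTime lam s0 x st.1 * statProb x st) +
          (1 - β) * (stateTime lam s0 y st.1 * statProb y st)) (st : G.Step) :
    tStep lam s0 (toB z) st = β * tStep lam s0 (toB x) st + (1 - β) * tStep lam s0 (toB y) st := by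
  have h := (isFlow_stateTime hlam hlam1 s0 z).eq hlam hlam1
    ((isFlow_stateTime hlam hlam1 s0 x).mix (isFlow_stateTime hlam hlam1 s0 y) β hz)
  rw [tStep_toB hlam hlam1, tStep_toB hlam hlam1, tStep_toB hlam hlam1, h, hz]

lemma statProb_eq (hMDP : ∀ j j' : G.I, j = j') (i : G.I) (x : G.StatProf) (st : G.Step) :
    statProb x st = (x i st.1).1 (st.2 i) :=
  haveI : Subsingleton G.I := ⟨hMDP⟩
  Fintype.prod_subsingleton _ i

lemma exists_statProf (hMDP : ∀ j j' : G.I, j = j') (i : G.I) (p : G.Stat i) :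
    ∃ x : G.StatProf, x i = p :=
  ⟨fun j => hMDP i j ▸ p, rfl⟩

lemma Mixed.le_one {α : Type} [Fintype α] (p : Mixed α) (a : α) : p.1 a ≤ 1 :=
  (Finset.single_le_sum (fun a _ => p.2.1 a) (Finset.mem_univ a)).trans_eq p.2.2

/-- The stationary strategies in a Markov decision process whose state-action time vector
lies in a given closed set form a closed set. -/
lemma isClosed_stationary {lam : ℝ} (hlam : 0 ≤ lam) (hlam1 : lam < 1) (s0 : G.S)
    (hMDP : ∀ j j' : G.I, j = j') (i : G.I) {C : Set (G.Step → ℝ)} (hC : IsClosed C) :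
    IsClosed {v : (Σ s : G.S, G.A i s) → ℝ | ∃ x : G.StatProf,
      (∀ pa : Σ s : G.S, G.A i s, (x i pa.1).1 pa.2 = v pa) ∧ tStep lam s0 (toB x) ∈ C} := by
  let X := ((Σ s : G.S, G.A i s) → ℝ) × (G.S → ℝ)
  let ev (p : X) (st : G.Step) : ℝ := p.1 ⟨st.1, st.2 i⟩
  have hev : ∀ st, Continuous fun p : X => ev p st := fun st =>
    (continuous_apply _).comp continuous_fst
  have hm : ∀ s, Continuous fun p : X => p.2 s := fun s =>
    (continuous_apply _).comp continuous_snd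
  let K : Set X := Set.Icc 0 1 ∩ ({p | ∀ s, ∑ a, p.1 ⟨s, a⟩ = 1} ∩
    ({p | IsFlow lam s0 (ev p) p.2} ∩ {p | (fun st : G.Step => p.2 st.1 * ev p st) ∈ C}))
  have hK : IsCompact K := by
    refine isCompact_Icc.inter_right (IsClosed.inter ?_ (IsClosed.inter ?_ ?_))
    · simp only [Set.ofPred_forall]
      exact isClosed_iInter fun s => isClosed_eq (continuous_finsetSum _ fun a _ =>
        (continuous_apply _).comp continuous_fst) continuous_const
    · simp only [IsFlow, Set.ofPred_forall]
      exact isClosed_iInter fun s => isClosed_eq (hm s) (continuous_const.add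
        (continuous_const.mul (continuous_finsetSum _ fun st _ =>
          ((hm st.1).mul (hev st)).mul continuous_const)))
    · exact hC.preimage (continuous_pi fun st => (hm st.1).mul (hev st))
  convert (hK.image continuous_fst).isClosed using 1
  ext v
  constructor
  · rintro ⟨x, hx, hxC⟩
    obtain rfl : (fun pa => (x i pa.1).1 pa.2) = v := funext hx
    have hp : ev (fun pa => (x i pa.1).1 pa.2, stateTime lam s0 x) = statProb x :=
      funext fun st => (statProb_eq hMDP i x st).symm
    refine ⟨(_, stateTime lam s0 x), ⟨⟨⟨fun pa => (x i pa.1).2.1 pa.2,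
      fun s => (stateTime_mem_Icc hlam hlam1 s0 x s).1⟩, fun pa => (x i pa.1).le_one pa.2,
      fun s => (stateTime_mem_Icc hlam hlam1 s0 x s).2⟩, fun s => (x i s).2.2, ?_, ?_⟩, rfl⟩
    · change IsFlow _ _ (ev _) _
      rw [hp]
      exact isFlow_stateTime hlam hlam1 s0 x
    · have : (fun st : G.Step => stateTime lam s0 x st.1 * statProb x st) ∈ C := by
        rwa [← funext (tStep_toB hlam hlam1 s0 x)]
      rwa [← hp] at this
  · rintro ⟨⟨v, m⟩, ⟨hIcc, hsum, hflow, hmC⟩, rfl⟩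
    obtain ⟨x, hx⟩ := exists_statProf hMDP i
      fun s => ⟨fun a => v ⟨s, a⟩, fun a => hIcc.1.1 ⟨s, a⟩, hsum s⟩
    have hp : ev (v, m) = statProb x := funext fun st => by
      rw [statProb_eq hMDP i, hx]
    have hflow' : IsFlow lam s0 (ev (v, m)) m := hflow
    have hmC' : (fun st : G.Step => m st.1 * ev (v, m) st) ∈ C := hmC
    rw [hp] at hflow' hmC'
    refine ⟨x, fun pa => by rw [hx], ?_⟩
    rwa [funext (tStep_toB hlam hlam1 s0 x), (isFlow_stateTime hlam hlam1 s0 x).eq hlam hlam1 hflow']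

/-! ### Monotone paths -/

/-- The clamped affine function with value `1` on `[0, 1/3]` and `0` on `[2/3, 1]`. -/
def rampDown (t : ℝ) : ℝ := max 0 (min 1 (2 - 3 * t))

lemma continuous_rampDown : Continuous rampDown := by
  unfold rampDown
  fun_prop

lemma antitone_rampDown : Antitone rampDown := fun s t h => by
  unfold rampDown
  gcongr

lemma rampDown_mem_Icc (t : ℝ) : rampDown t ∈ Set.Icc 0 1 :=
  ⟨le_max_left _ _, max_le zero_le_one (min_le_left _ _)⟩

lemma rampDown_of_le {t : ℝ} (h : 3 * t ≤ 1) : rampDown t = 1 := by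
  rw [rampDown, min_eq_left (by linarith), max_eq_right zero_le_one]

lemma rampDown_of_ge {t : ℝ} (h : 2 ≤ 3 * t) : rampDown t = 0 :=
  max_eq_left ((min_le_right _ _).trans (by linarith))

/-- The weights along which two stationary strategies spending times `a` and `b` at a state
are to be mixed at this state. -/
lemma exists_mixWeight {a b : ℝ} (ha : 0 ≤ a) (hb : 0 ≤ b) :
    ∃ w : ℝ → ℝ, Continuous w ∧ Antitone w ∧ w 0 = 1 ∧ w 1 = 0 ∧
      ∀ t, (rampDown t * a + (1 - rampDown t) * b) * w t = rampDown t * a := by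
  rcases ha.eq_or_lt with rfl | ha
  · refine ⟨fun t => max 0 (1 - 3 * t), by fun_prop, fun s t h => ?_, by norm_num, by norm_num,
      fun t => ?_⟩
    · dsimp only
      gcongr
    · rcases le_total (3 * t) 1 with h | h
      · simp [rampDown_of_le h]
      · simp [max_eq_left (sub_nonpos.2 h)]
  rcases hb.eq_or_lt with rfl | hb
  · refine ⟨fun t => min 1 (3 - 3 * t), by fun_prop, fun s t h => ?_, by norm_num, by norm_num,
      fun t => ?_⟩
    · dsimp only
      gcongr
    · rcases le_total 2 (3 * t) with h | h
      · simp [rampDown_of_ge h]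
      · simp [min_eq_left (show 1 ≤ 3 - 3 * t by linarith)]
  have hpos : ∀ t, 0 < rampDown t * a + (1 - rampDown t) * b := by
    intro t
    obtain ⟨h0, h1⟩ := rampDown_mem_Icc t
    rcases h0.eq_or_lt with h | h
    · rw [← h]
      linarith
    · have := mul_pos h ha
      have := mul_nonneg (sub_nonneg.2 h1) hb.le
      linarith
  refine ⟨fun t => rampDown t * a / (rampDown t * a + (1 - rampDown t) * b), ?_, ?_, ?_, ?_, ?_⟩
  · have := continuous_rampDown
    exact Continuous.div (by fun_prop) (by fun_prop) fun t => (hpos t).ne'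
  · intro s t h
    dsimp only
    rw [div_le_div_iff₀ (hpos t) (hpos s)]
    nlinarith [mul_le_mul_of_nonneg_left (antitone_rampDown h) (mul_pos ha hb).le]
  · simp [rampDown_of_le, ha.ne']
  · simp [rampDown_of_ge (show (2 : ℝ) ≤ 3 * 1 by norm_num)]
  · intro t
    exact mul_div_cancel₀ _ (hpos t).ne'

/-- A set of stationary strategies in a Markov decision process is monovex whenever the
corresponding set of state-action time vectors is convex. -/
lemma monovex_stationary {lam : ℝ} (hlam : 0 ≤ lam) (hlam1 : lam < 1) (s0 : G.S)
    (hMDP : ∀ j j' : G.I, j = j') (i : G.I) (Q : G.StatProf → Prop)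
    (hQ : ∀ x y z : G.StatProf, Q x → Q y → ∀ β ∈ Set.Icc (0 : ℝ) 1,
      (∀ st, tStep lam s0 (toB z) st =
        β * tStep lam s0 (toB x) st + (1 - β) * tStep lam s0 (toB y) st) → Q z) :
    Monovex {v : (Σ s : G.S, G.A i s) → ℝ | ∃ x : G.StatProf,
      (∀ pa : Σ s : G.S, G.A i s, (x i pa.1).1 pa.2 = v pa) ∧ Q x} := by
  rintro v ⟨x, hx, hxQ⟩ v' ⟨y, hy, hyQ⟩
  choose w hwc hwa hw0 hw1 hw using fun s : G.S => exists_mixWeight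
    (stateTime_nonneg hlam hlam1 s0 x s) (stateTime_nonneg hlam hlam1 s0 y s)
  refine ⟨fun t pa => w pa.1 t * v pa + (1 - w pa.1 t) * v' pa, ?_, fun t ht => ?_, ?_, ?_, ?_⟩
  · refine (continuous_pi fun pa => ?_).continuousOn
    have := hwc pa.1
    fun_prop
  · have hw_nonneg : ∀ s, 0 ≤ w s t := fun s => hw1 s ▸ hwa s ht.2
    have hw_le : ∀ s, 0 ≤ 1 - w s t := fun s => sub_nonneg.2 (hw0 s ▸ hwa s ht.1)
    obtain ⟨z, hz⟩ := exists_statProf hMDP i fun s =>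
      ⟨fun a => w s t * (x i s).1 a + (1 - w s t) * (y i s).1 a,
        fun a => add_nonneg (mul_nonneg (hw_nonneg s) ((x i s).2.1 a))
          (mul_nonneg (hw_le s) ((y i s).2.1 a)), by
        rw [Finset.sum_add_distrib, ← Finset.mul_sum, ← Finset.mul_sum, (x i s).2.2, (y i s).2.2]
        ring⟩
    refine ⟨z, fun pa => by simp only [hz, hx, hy], hQ x y z hxQ hyQ _ (rampDown_mem_Icc t)
      (tStep_toB_mix hlam hlam1 s0 _ fun st => ?_)⟩
    simp only [statProb_eq hMDP i, hz]
    linear_combination ((x i st.1).1 (st.2 i) - (y i st.1).1 (st.2 i)) * hw st.1 t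
  · funext pa
    simp [hw0]
  · funext pa
    simp [hw1]
  · intro pa
    rcases le_total (v pa) (v' pa) with h | h
    · refine Or.inl fun s _ t _ hst => ?_
      dsimp only
      nlinarith [mul_nonneg (sub_nonneg.2 (hwa pa.1 hst)) (sub_nonneg.2 h)]
    · refine Or.inr fun s _ t _ hst => ?_
      dsimp only
      nlinarith [mul_nonneg (sub_nonneg.2 (hwa pa.1 hst)) (sub_nonneg.2 h)]

end StocGame

end

open StocGame in
/-- in a Markov decision process, the set of stationary maximizers of a
function of the state-action discounted time vector that is quasiconcave under mixing
is a closed monovex set. -/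
theorem stmt_3 (G : StocGame) (hMDP : ∀ j j' : G.I, j = j') (i : G.I)
    (g : G.Profile → ℝ) (lam : ℝ) (hlam0 : 0 < lam) (hlam1 : lam < 1) (s0 : G.S)
    (f : (G.Step → ℝ) → ℝ) (hf : Continuous f)
    (hgf : ∀ σ : G.Profile, g σ = f (fun st => tStep lam s0 σ st))
    (hqc : ∀ σ σ' : G.Profile, ∀ β : ℝ, 0 ≤ β → β ≤ 1 → ∀ τ : G.Profile,
      (∀ st : G.Step, tStep lam s0 τ st =
        β * tStep lam s0 σ st + (1 - β) * tStep lam s0 σ' st) →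
      β * g σ + (1 - β) * g σ' ≤ g τ) :
    IsClosed {v : (Σ s : G.S, G.A i s) → ℝ | ∃ x : G.StatProf,
        (∀ pa : Σ s : G.S, G.A i s, (x i pa.1).1 pa.2 = v pa) ∧
        g (toB x) = ⨆ σ : G.Profile, g σ} ∧
    Monovex {v : (Σ s : G.S, G.A i s) → ℝ | ∃ x : G.StatProf,
        (∀ pa : Σ s : G.S, G.A i s, (x i pa.1).1 pa.2 = v pa) ∧
        g (toB x) = ⨆ σ : G.Profile, g σ} := by
  have hbdd : BddAbove (Set.range g) := by
    obtain ⟨C, hC⟩ := exists_tStep_mem_Icc hlam0 hlam1 s0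
    refine ((isCompact_univ_pi fun _ : G.Step => isCompact_Icc (a := (0 : ℝ)) (b := C)).image
      hf).bddAbove.mono ?_
    rintro _ ⟨σ, rfl⟩
    exact ⟨_, fun st _ => hC σ st, (hgf σ).symm⟩
  constructor
  · simp only [hgf (toB _)]
    exact isClosed_stationary hlam0.le hlam1 s0 hMDP i
      (isClosed_eq hf (continuous_const (y := ⨆ σ : G.Profile, g σ)))
  · refine monovex_stationary hlam0.le hlam1 s0 hMDP i _ fun x y z hx hy β hβ hz => ?_
    refine le_antisymm (le_ciSup hbdd _) ?_
    have h := hqc (toB x) (toB y) β hβ.1 hβ.2 (toB z) hz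
    rw [hx, hy] at h
    linarith
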